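/- Let Γ be a finite connected multigraph, σ a degree-d stability assignment for Γ, and m : Edges(Γ) → ℕ. Then the number of elements of the lift σ̃_m equals Σ_G ( ∏_{e ∈ Edges(Γ)∖Edges(G)} m(e) ) · c(G), the sum over all connected spanning subgraphs G of Γ; in particular |σ̃_m| equals the complexity c(Γ̃_m) of the subdivision Γ̃_m. -/

import Mathlib

open Finset

variable {V E : Type} [Fintype V] [Fintype E] [DecidableEq V] [DecidableEq E]

/-- The unordered pair of endpoints of an edge. -/
def eSym (ends : E → V × V) (e : E) : Sym2 V := s((ends e).1, (ends e).2)

/-- Reachability in the spanning subgraph with edge set `A`. -/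
def Linked (ends : E → V × V) (A : Finset E) : V → V → Prop :=
  Relation.ReflTransGen (fun v w => ∃ e ∈ A, eSym ends e = s(v, w))

/-- The spanning subgraph with edge set `A` is connected. -/
def Conn (ends : E → V × V) (A : Finset E) : Prop :=
  Nonempty V ∧ ∀ v w : V, Linked ends A v w

/-- The induced subgraph on the vertex set `W` is connected. -/
def ConnOn (ends : E → V × V) (W : Finset V) : Prop :=
  W.Nonempty ∧ ∀ v ∈ W, ∀ w ∈ W,
    Relation.ReflTransGen (fun a b => a ∈ W ∧ b ∈ W ∧ ∃ e : E, eSym ends e = s(a, b)) v w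

/-- A spanning tree: a connected spanning subgraph with `|V| - 1` edges. -/
def IsSpanningTree (ends : E → V × V) (A : Finset E) : Prop :=
  Conn ends A ∧ A.card + 1 = Fintype.card V

/-- The complexity of the spanning subgraph `A`: the number of its spanning trees. -/
noncomputable def complexity (ends : E → V × V) (A : Finset E) : ℕ :=
  Nat.card {T : Finset E // T ⊆ A ∧ IsSpanningTree ends T}

/-- `n(G)`: the number of edges of `Γ` missing from the spanning subgraph `G`. -/
def nG (A : Finset E) : ℕ := (Finset.univ \ A).card

/-- The space of multidegrees of total degree `d` at `A`. -/
def Sdeg (d : ℤ) (A : Finset E) : Set (V → ℤ) :=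
  {x | ∑ v, x v = d - (nG A : ℤ)}

/-- The twister at vertex `v` of the spanning subgraph with edge set `A`. -/
def twVec (ends : E → V × V) (A : Finset E) (v : V) : V → ℤ := fun w =>
  if w = v then
    -((A.filter (fun e => v ∈ eSym ends e ∧ ¬(eSym ends e).IsDiag)).card : ℤ)
  else ((A.filter (fun e => eSym ends e = s(v, w))).card : ℤ)

/-- The twister (chip-firing) group of the spanning subgraph with edge set `A`. -/
def twGroup (ends : E → V × V) (A : Finset E) : AddSubgroup (V → ℤ) :=
  AddSubgroup.closure (Set.range (twVec ends A))

/-- The standard basis vector at `v`. -/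
def stdVec (v : V) : V → ℤ := fun w => if w = v then 1 else 0

/-- A degree-`d` assignment: supported on connected spanning subgraphs, with the
prescribed total degree. -/
def IsAssignment (ends : E → V × V) (d : ℤ) (σ : Finset E → Set (V → ℤ)) : Prop :=
  ∀ A : Finset E, ∀ x ∈ σ A, Conn ends A ∧ x ∈ Sdeg d A

/-- Condition (1), chip-adding. -/
def ChipAdding (ends : E → V × V) (σ : Finset E → Set (V → ℤ)) : Prop :=
  ∀ A : Finset E, ∀ x ∈ σ A, ∀ e ∉ A, ∀ v ∈ eSym ends e, x + stdVec v ∈ σ (insert e A)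

/-- `S` is a minimal complete set of representatives for the action of the twister group
of `A` on the multidegree space `S^d(A)`. -/
def IsRepSet (ends : E → V × V) (d : ℤ) (A : Finset E) (S : Set (V → ℤ)) : Prop :=
  S ⊆ Sdeg d A ∧ ∀ x ∈ Sdeg (E := E) d A, ∃! y, y ∈ S ∧ x - y ∈ twGroup ends A

/-- A degree-`d` stability assignment. -/
def IsStabilityAssignment (ends : E → V × V) (d : ℤ) (σ : Finset E → Set (V → ℤ)) : Prop :=
  IsAssignment ends d σ ∧ ChipAdding ends σ ∧
    ∀ A : Finset E, Conn ends A → IsRepSet ends d A (σ A)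

/-- Vertices of the subdivision `Γ̃_m`: original vertices plus, for each edge `e`,
`m e` exceptional vertices. -/
abbrev SubV (V E : Type) (m : E → ℕ) : Type := V ⊕ (Σ e : E, Fin (m e))

/-- Edges of the subdivision `Γ̃_m`: each edge `e` is replaced by a chain of `m e + 1` edges. -/
abbrev SubE (E : Type) (m : E → ℕ) : Type := Σ e : E, Fin (m e + 1)

/-- The `i`-th vertex along the chain replacing the edge `e` in the subdivision. -/
def subNode (ends : E → V × V) (m : E → ℕ) (e : E) (i : ℕ) : SubV V E m :=
  if h0 : i = 0 then Sum.inl (ends e).1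
  else if h : i ≤ m e then Sum.inr ⟨e, ⟨i - 1, by omega⟩⟩
  else Sum.inl (ends e).2

/-- The endpoints of the edges of the subdivision `Γ̃_m`. -/
def subEnds (ends : E → V × V) (m : E → ℕ) : SubE E m → SubV V E m × SubV V E m :=
  fun p => (subNode ends m p.1 p.2.val, subNode ends m p.1 (p.2.val + 1))

/-- The lift of the multidegree `x` on `(A, Γ)`: extend by zero and add one chip on
the exceptional vertex `t e` of every removed edge `e ∉ A`. -/
def liftOf (m : E → ℕ) (A : Finset E) (x : V → ℤ) (t : E → ℕ) : SubV V E m → ℤ :=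
  Sum.elim x fun p => if p.1 ∉ A ∧ (p.2 : ℕ) = t p.1 then 1 else 0

/-- The lift `σ̃_m` of an assignment `σ`: all lifts of all elements of `σ`. -/
def liftSet (m : E → ℕ) (σ : Finset E → Set (V → ℤ)) : Set (SubV V E m → ℤ) :=
  {y | ∃ (A : Finset E) (x : V → ℤ) (t : E → ℕ),
    x ∈ σ A ∧ (∀ e ∉ A, t e < m e) ∧ y = liftOf m A x t}

/-- Edges with both endpoints in `W` (the edges of the induced subgraph `Γ(W)`). -/
def inE (ends : E → V × V) (W : Finset V) : Finset E :=
  Finset.univ.filter fun e => (ends e).1 ∈ W ∧ (ends e).2 ∈ W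

/-- Edges with one endpoint in `W` and the other in `Wᶜ`. -/
def cutE (ends : E → V × V) (W : Finset V) : Finset E :=
  Finset.univ.filter fun e =>
    ((ends e).1 ∈ W ∧ (ends e).2 ∉ W) ∨ ((ends e).1 ∉ W ∧ (ends e).2 ∈ W)

/-- `φ`-semistability of the multidegree `x` on the spanning subgraph `A`. -/
def PhiSemistable (ends : E → V × V) (φ : V → ℝ) (A : Finset E) (x : V → ℤ) : Prop :=
  ∀ W : Finset V, W.Nonempty → W ≠ Finset.univ →
    |(∑ v ∈ W, ((x v : ℝ) - φ v)) + (((Finset.univ \ A) ∩ inE ends W).card : ℝ) +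
        (((Finset.univ \ A) ∩ cutE ends W).card : ℝ) / 2| ≤
      ((A ∩ cutE ends W).card : ℝ) / 2

/-- `φ`-stability of the multidegree `x` on the spanning subgraph `A`. -/
def PhiStable (ends : E → V × V) (φ : V → ℝ) (A : Finset E) (x : V → ℤ) : Prop :=
  ∀ W : Finset V, W.Nonempty → W ≠ Finset.univ →
    |(∑ v ∈ W, ((x v : ℝ) - φ v)) + (((Finset.univ \ A) ∩ inE ends W).card : ℝ) +
        (((Finset.univ \ A) ∩ cutE ends W).card : ℝ) / 2| <
      ((A ∩ cutE ends W).card : ℝ) / 2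

/-- Nondegeneracy of a numerical polarization `φ`. -/
def Nondegenerate (ends : E → V × V) (d : ℤ) (φ : V → ℝ) : Prop :=
  ∀ A : Finset E, ∀ x ∈ Sdeg d A, PhiSemistable ends φ A x → PhiStable ends φ A x

/-- The assignment `stab_{Γ,φ}` associated with a numerical polarization `φ`. -/
def stabAssign (ends : E → V × V) (d : ℤ) (φ : V → ℝ) : Finset E → Set (V → ℤ) :=
  fun A => {x | Conn ends A ∧ x ∈ Sdeg d A ∧ PhiSemistable ends φ A x}

/-- The valence of the vertex `v` (loops counted twice). -/
def valence (ends : E → V × V) (v : V) : ℕ :=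
  ∑ e : E, ((if (ends e).1 = v then 1 else 0) + (if (ends e).2 = v then 1 else 0))

/-- `x` is an integral break divisor for the connected spanning subgraph `A`. -/
def isIBD (ends : E → V × V) (gen : V → ℕ) (A : Finset E) (x : V → ℤ) : Prop :=
  ∃ T : Finset E, T ⊆ A ∧ IsSpanningTree ends T ∧
    ∃ t : E → V, (∀ e ∈ A \ T, t e ∈ eSym ends e) ∧
      x = fun v => (gen v : ℤ) + (((A \ T).filter fun e => t e = v).card : ℤ)

/-- The multidegree `(a, b)` on a two-vertex graph with first vertex `v₁`. -/
def pairFn (v₁ : V) (a b : ℤ) : V → ℤ := fun w => if w = v₁ then a else b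


section CauchyBinet

variable {n ι R : Type*} [Fintype n] [DecidableEq n] [Fintype ι] [CommRing R]

theorem Matrix.det_mul_transpose_eq_sum_fun (B : Matrix n ι R) :
    (B * B.transpose).det = ∑ f : n → ι, (∏ i, B i (f i)) * (B.submatrix id f).det := by
  classical
  simp only [Matrix.det_apply', Matrix.mul_apply, prod_univ_sum, mul_sum, Fintype.piFinset_univ]
  rw [Finset.sum_comm]
  refine sum_congr rfl fun f _ => sum_congr rfl fun τ _ => ?_
  simp only [Matrix.transpose_apply, Matrix.submatrix_apply, id, prod_mul_distrib]
  ring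

variable [DecidableEq ι]

/-- The **Cauchy-Binet formula** for `B * Bᵀ`. The squared minor of `B` on a set `S` of columns
does not depend on the enumeration of `S`; it is recorded by the function `q`. -/
theorem Matrix.det_mul_transpose_eq_sum_powersetCard (B : Matrix n ι R) (q : Finset ι → R)
    (hq : ∀ g : n → ι, Function.Injective g → (B.submatrix id g).det ^ 2 = q (univ.image g)) :
    (B * B.transpose).det = ∑ S ∈ powersetCard (Fintype.card n) univ, q S := by
  rw [B.det_mul_transpose_eq_sum_fun]
  have hinj : ∑ f : n → ι, (∏ i, B i (f i)) * (B.submatrix id f).det =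
      ∑ f : n → ι with Function.Injective f, (∏ i, B i (f i)) * (B.submatrix id f).det := by
    refine (sum_subset (filter_subset _ _) fun f _ hf => ?_).symm
    have hninj : ¬Function.Injective f := fun h => hf (mem_filter.2 ⟨mem_univ _, h⟩)
    obtain ⟨i, j, hij, hne⟩ : ∃ i j, f i = f j ∧ i ≠ j := by
      simpa [Function.Injective] using hninj
    rw [Matrix.det_zero_of_column_eq hne (fun k => by simp [hij]), mul_zero]
  rw [hinj, ← sum_fiberwise_of_maps_to (t := powersetCard (Fintype.card n) univ)
    (g := fun f : n → ι => univ.image f)]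
  · refine sum_congr rfl fun S hS => ?_
    obtain ⟨g, hg, rfl⟩ : ∃ g : n → ι, Function.Injective g ∧ univ.image g = S := by
      have e : n ≃ S := Fintype.equivOfCardEq (by simpa using (mem_powersetCard.1 hS).2.symm)
      refine ⟨fun i => e i, Subtype.val_injective.comp e.injective, ?_⟩
      ext a
      simp only [mem_image, mem_univ, true_and]
      exact ⟨fun ⟨i, hi⟩ => hi ▸ (e i).2, fun ha => ⟨e.symm ⟨a, ha⟩, by simp⟩⟩
    rw [← hq g hg]
    trans ∑ τ : Equiv.Perm n, (∏ i, B i (g (τ i))) * (B.submatrix id (g ∘ τ)).det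
    · symm
      refine sum_bij (fun τ _ => g ∘ τ) ?_ ?_ ?_ fun _ _ => rfl
      · intro τ _
        simp only [mem_filter, mem_univ, true_and]
        refine ⟨hg.comp τ.injective, ?_⟩
        ext a
        simp only [mem_image, mem_univ, true_and, Function.comp]
        exact ⟨fun ⟨i, hi⟩ => ⟨τ i, hi⟩, fun ⟨i, hi⟩ => ⟨τ.symm i, by simpa using hi⟩⟩
      · intro τ _ τ' _ h
        ext i
        exact hg (congrFun h i)
      · intro f hf
        simp only [mem_filter, mem_univ, true_and] at hf
        have hmem : ∀ i, ∃ j, g j = f i := fun i => by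
          have : f i ∈ univ.image g := hf.2 ▸ mem_image_of_mem f (mem_univ i)
          simpa using this
        choose p hp using hmem
        have hpinj : Function.Injective p := fun i j hij => hf.1 (by rw [← hp, ← hp, hij])
        exact ⟨Equiv.ofBijective p (Finite.injective_iff_bijective.1 hpinj), mem_univ _,
          funext hp⟩
    · have hdet : ∀ τ : Equiv.Perm n, (B.submatrix id (g ∘ τ)).det =
          Equiv.Perm.sign τ * (B.submatrix id g).det := fun τ => by
        rw [← Matrix.det_permute']; rfl
      have hexp : (B.submatrix id g).det =
          ∑ τ : Equiv.Perm n, ((Equiv.Perm.sign τ : ℤ) : R) * ∏ i, B i (g (τ i)) :=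
        (Matrix.det_transpose _).symm.trans (Matrix.det_apply' _)
      trans (∑ τ : Equiv.Perm n, ((Equiv.Perm.sign τ : ℤ) : R) * ∏ i, B i (g (τ i))) *
        (B.submatrix id g).det
      · rw [sum_mul]
        refine sum_congr rfl fun τ _ => ?_
        rw [hdet]
        ring
      · rw [← hexp, sq]
  · intro f hf
    simp only [mem_filter, mem_univ, true_and] at hf
    simp [mem_powersetCard, card_image_of_injective _ hf]

end CauchyBinet

set_option linter.unusedSectionVars false

theorem Linked.symm {V E : Type} {ends : E → V × V} {A : Finset E} {v w : V} (h : Linked ends A v w) :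
    Linked ends A w v := by
  induction h with
  | refl => exact .refl
  | tail _ hbc ih =>
    obtain ⟨e, he, hs⟩ := hbc
    exact .head ⟨e, he, by rw [hs, Sym2.eq_swap]⟩ ih

theorem Linked.ends {V E : Type} {ends : E → V × V} {A : Finset E} {e : E} (he : e ∈ A) :
    Linked ends A (ends e).1 (ends e).2 :=
  .single ⟨e, he, rfl⟩

theorem Linked.ends_swap {V E : Type} {ends : E → V × V} {A : Finset E} {e : E} (he : e ∈ A) :
    Linked ends A (ends e).2 (ends e).1 :=
  (Linked.ends he).symm

theorem Linked.map {V E V' E' : Type} {ends : E → V × V} {A : Finset E} {ends' : E' → V' × V'}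
    {A' : Finset E'} {f : V → V'}
    (hf : ∀ e ∈ A, Linked ends' A' (f (ends e).1) (f (ends e).2)) {v w : V}
    (h : Linked ends A v w) : Linked ends' A' (f v) (f w) := by
  induction h with
  | refl => exact .refl
  | tail _ hbc ih =>
    obtain ⟨e, he, hs⟩ := hbc
    have h1 := hf e he
    rcases Sym2.eq_iff.1 hs with ⟨h2, h3⟩ | ⟨h2, h3⟩ <;> rw [h2, h3] at h1
    · exact ih.trans h1
    · exact ih.trans h1.symm

theorem Linked.apply_eq {V E : Type} {α : Sort*}
    {ends : E → V × V} {A : Finset E} {f : V → α}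
    (hf : ∀ e ∈ A, f (ends e).1 = f (ends e).2) {v w : V} (h : Linked ends A v w) :
    f v = f w := by
  induction h with
  | refl => rfl
  | tail _ hbc ih =>
    obtain ⟨e, he, hs⟩ := hbc
    have h1 := hf e he
    rcases Sym2.eq_iff.1 hs with ⟨h2, h3⟩ | ⟨h2, h3⟩ <;> rw [h2, h3] at h1
    · rw [ih, h1]
    · rw [ih, h1]

theorem conn_of_linked_root {ends : E → V × V} {A : Finset E} (r : V)
    (h : ∀ v, Linked ends A r v) : Conn ends A :=
  ⟨⟨r⟩, fun v w => (h v).symm.trans (h w)⟩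

/-- The boundary `𝐞_a - 𝐞_b` of an edge `e` with endpoints `(a, b)`. -/
def edgeBoundary (ends : E → V × V) (e : E) : V → ℤ :=
  stdVec (ends e).1 - stdVec (ends e).2

theorem sum_mul_stdVec (f : V → ℤ) (a : V) : ∑ v, f v * stdVec a v = f a := by
  simp [stdVec]

theorem sum_mul_edgeBoundary (ends : E → V × V) (f : V → ℤ) (e : E) :
    ∑ v, f v * edgeBoundary ends e v = f (ends e).1 - f (ends e).2 := by
  simp only [edgeBoundary, Pi.sub_apply, mul_sub, sum_sub_distrib, sum_mul_stdVec]

theorem sum_edgeBoundary (ends : E → V × V) (e : E) : ∑ v, edgeBoundary ends e v = 0 := by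
  simpa using sum_mul_edgeBoundary ends 1 e

theorem sum_eq_add_sum_ne (r : V) (f : V → ℤ) :
    ∑ v, f v = f r + ∑ v : {v // v ≠ r}, f v := by
  rw [← add_sum_erase univ f (mem_univ r)]
  congr 1
  exact (sum_subtype _ (by simp) f)

theorem sum_ne_mul_edgeBoundary (ends : E → V × V) (r : V) (f : V → ℤ) (hf : f r = 0) (e : E) :
    ∑ v : {v // v ≠ r}, f v * edgeBoundary ends e v = f (ends e).1 - f (ends e).2 := by
  rw [← sum_mul_edgeBoundary, sum_eq_add_sum_ne r (fun v => f v * edgeBoundary ends e v), hf]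
  simp

/-- The incidence matrix of the spanning subgraph `A`, with the row of the vertex `r` removed
and zero columns for the edges outside `A`. -/
def reducedIncidence (ends : E → V × V) (r : V) (A : Finset E) : Matrix {v // v ≠ r} E ℤ :=
  fun v e => if e ∈ A then edgeBoundary ends e v else 0

/-- The reduced Laplacian of the spanning subgraph `A`, with respect to the root `r`. -/
def reducedLaplacian (ends : E → V × V) (r : V) (A : Finset E) :
    Matrix {v // v ≠ r} {v // v ≠ r} ℤ :=
  reducedIncidence ends r A * (reducedIncidence ends r A).transpose

theorem reducedLaplacian_apply (ends : E → V × V) (r : V) (A : Finset E) (v w : {v // v ≠ r}) :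
    reducedLaplacian ends r A v w = ∑ e ∈ A, edgeBoundary ends e v * edgeBoundary ends e w := by
  simp [reducedLaplacian, reducedIncidence, Matrix.mul_apply]

/-- Restriction of multidegrees to the vertices different from the root. -/
def restrictNe (r : V) : (V → ℤ) →ₗ[ℤ] ({v // v ≠ r} → ℤ) :=
  LinearMap.funLeft ℤ ℤ Subtype.val

theorem restrictNe_apply (r : V) (x : V → ℤ) (v : {v // v ≠ r}) : restrictNe r x v = x v := rfl

theorem isUnit_det_minor_of_conn {ends : E → V × V} {r : V} {A : Finset E}
    {g : {v // v ≠ r} → E} (hgA : univ.image g ⊆ A) (hc : Conn ends (univ.image g)) :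
    IsUnit ((reducedIncidence ends r A).submatrix id g).det := by
  set M := (reducedIncidence ends r A).submatrix id g
  rw [← Matrix.isUnit_iff_isUnit_det, ← Matrix.mulVec_surjective_iff_isUnit]
  have hcol : ∀ j, restrictNe r (edgeBoundary ends (g j)) ∈ LinearMap.range M.mulVecLin := by
    refine fun j => ⟨Pi.single j 1, ?_⟩
    ext v
    simp [M, reducedIncidence, restrictNe_apply, hgA (mem_image_of_mem g (mem_univ j))]
  have hstd : ∀ v, restrictNe r (stdVec v) ∈ LinearMap.range M.mulVecLin := by
    intro v
    have h := hc.2 r v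
    induction h with
    | refl =>
      convert Submodule.zero_mem _
      ext v
      simp [restrictNe_apply, stdVec, v.2]
    | tail _ hbc ih =>
      obtain ⟨e, he, hs⟩ := hbc
      obtain ⟨j, -, rfl⟩ := mem_image.1 he
      have hj := hcol j
      rw [edgeBoundary, map_sub] at hj
      rcases Sym2.eq_iff.1 hs with ⟨h1, h2⟩ | ⟨h1, h2⟩ <;> rw [h1, h2] at hj
      · simpa using sub_mem ih hj
      · simpa using add_mem hj ih
  intro y
  have hy : y = ∑ v : {v // v ≠ r}, y v • restrictNe r (stdVec (v : V)) := by
    ext w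
    simp [restrictNe_apply, stdVec, Subtype.val_inj]
  have hmem : y ∈ LinearMap.range M.mulVecLin := by
    rw [hy]
    exact Submodule.sum_mem _ fun v _ => Submodule.smul_mem _ _ (hstd v)
  exact hmem

theorem det_minor_eq_zero_of_not_conn {ends : E → V × V} {r : V} {A : Finset E}
    {g : {v // v ≠ r} → E} (hc : ¬Conn ends (univ.image g)) :
    ((reducedIncidence ends r A).submatrix id g).det = 0 := by
  classical
  obtain ⟨u, hu⟩ : ∃ u, ¬Linked ends (univ.image g) r u := by
    by_contra! h
    exact hc (conn_of_linked_root r h)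
  let χ : V → ℤ := fun v => if Linked ends (univ.image g) r v then 0 else 1
  have hχr : χ r = 0 := if_pos .refl
  rw [← Matrix.exists_vecMul_eq_zero_iff]
  refine ⟨fun v => χ v, fun h0 => ?_, ?_⟩
  · have hur : u ≠ r := fun h => hu (by rw [h]; exact .refl)
    have := congrFun h0 ⟨u, hur⟩
    simp [χ, hu] at this
  · ext j
    by_cases hj : g j ∈ A
    · simp only [Matrix.vecMul, dotProduct, Matrix.submatrix_apply, id, reducedIncidence, hj,
        if_true, Pi.zero_apply]
      rw [sum_ne_mul_edgeBoundary ends r χ hχr, sub_eq_zero]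
      have hmem : g j ∈ univ.image g := mem_image_of_mem g (mem_univ j)
      have hiff : Linked ends (univ.image g) r (ends (g j)).1 ↔
          Linked ends (univ.image g) r (ends (g j)).2 :=
        ⟨fun h => h.trans (Linked.ends hmem), fun h => h.trans (Linked.ends_swap hmem)⟩
      simp only [χ, hiff]
    · simp [Matrix.vecMul, dotProduct, reducedIncidence, hj]

/-- **Kirchhoff's matrix-tree theorem.** -/
theorem det_reducedLaplacian (ends : E → V × V) (r : V) (A : Finset E) :
    (reducedLaplacian ends r A).det = complexity ends A := by
  classical
  have hcard : Fintype.card {v // v ≠ r} + 1 = Fintype.card V := by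
    have := Fintype.card_subtype_compl (fun v => v = r)
    have hpos : 0 < Fintype.card V := Fintype.card_pos_iff.2 ⟨r⟩
    simp only [Fintype.card_subtype_eq] at this
    simp only [ne_eq]
    omega
  rw [reducedLaplacian, Matrix.det_mul_transpose_eq_sum_powersetCard _
    (fun S => if S ⊆ A ∧ IsSpanningTree ends S then 1 else 0)]
  · rw [complexity, sum_boole, Nat.subtype_card _ (fun T => ?_)]
    simp only [mem_filter, mem_powersetCard, subset_univ, true_and, and_iff_right_iff_imp]
    intro h
    have := h.2.2
    omega
  · intro g hg
    have hgcard : (univ.image g).card + 1 = Fintype.card V := by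
      rw [card_image_of_injective _ hg, card_univ, hcard]
    by_cases hgA : univ.image g ⊆ A
    · by_cases hc : Conn ends (univ.image g)
      · rw [if_pos ⟨hgA, hc, hgcard⟩]
        rcases Int.isUnit_iff.1 (isUnit_det_minor_of_conn hgA hc) with h | h <;> simp [h]
      · rw [det_minor_eq_zero_of_not_conn hc, if_neg fun h => hc h.2.1]
        simp
    · rw [if_neg fun h => hgA h.1]
      obtain ⟨j, hj⟩ : ∃ j, g j ∉ A := by
        by_contra! h
        exact hgA fun e he => by
          obtain ⟨j, -, rfl⟩ := mem_image.1 he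
          exact h j
      rw [Matrix.det_eq_zero_of_column_eq_zero j fun v => by simp [reducedIncidence, hj]]
      simp

theorem det_reducedLaplacian_ne_zero {ends : E → V × V} {A : Finset E} (r : V)
    (hA : Conn ends A) : (reducedLaplacian ends r A).det ≠ 0 := by
  intro h0
  obtain ⟨x, hx0, hx⟩ := Matrix.exists_vecMul_eq_zero_iff.2 h0
  set B := reducedIncidence ends r A with hB
  have hBx : Matrix.vecMul x B = 0 := by
    rw [← dotProduct_self_eq_zero]
    calc Matrix.vecMul x B ⬝ᵥ Matrix.vecMul x B
        = Matrix.vecMul x (reducedLaplacian ends r A) ⬝ᵥ x := by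
          rw [reducedLaplacian, ← hB, ← Matrix.vecMul_vecMul, Matrix.vecMul_transpose,
            dotProduct_comm _ x, Matrix.dotProduct_mulVec]
      _ = 0 := by rw [hx, zero_dotProduct]
  let f : V → ℤ := fun v => if h : v = r then 0 else x ⟨v, h⟩
  have hfr : f r = 0 := dif_pos rfl
  have hfx : ∀ v : {v // v ≠ r}, f v = x v := fun v => dif_neg v.2
  have hedge : ∀ e ∈ A, f (ends e).1 = f (ends e).2 := by
    intro e he
    rw [← sub_eq_zero, ← sum_ne_mul_edgeBoundary ends r f hfr e]
    have := congrFun hBx e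
    simpa [Matrix.vecMul, dotProduct, hB, reducedIncidence, he, hfx] using this
  have hlink : ∀ v, f v = 0 := fun v => ((hA.2 r v).apply_eq hedge).symm.trans hfr
  exact hx0 (funext fun v => by rw [← hfx, hlink]; rfl)

theorem Matrix.card_quotient_range_mulVecLin {n : Type*} [Fintype n] [DecidableEq n]
    (L : Matrix n n ℤ) (hL : L.det ≠ 0) :
    Nat.card ((n → ℤ) ⧸ LinearMap.range L.mulVecLin) = L.det.natAbs := by
  have hinj : Function.Injective L.mulVecLin := Matrix.mulVec_injective_of_det_ne_zero hL
  rw [← Submodule.natAbs_det_equiv _ (LinearEquiv.ofInjective L.mulVecLin hinj)]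
  have : (LinearMap.range L.mulVecLin).subtype ∘ₗ AddMonoidHom.toIntLinearMap
      ((LinearEquiv.ofInjective L.mulVecLin hinj :
        (n → ℤ) ≃ₗ[ℤ] LinearMap.range L.mulVecLin) : (n → ℤ) →+ LinearMap.range L.mulVecLin) =
      Matrix.toLin' L := by
    ext; rfl
  rw [this, LinearMap.det_toLin']

theorem twVec_apply (ends : E → V × V) (A : Finset E) (v w : V) :
    twVec ends A v w = -∑ e ∈ A, edgeBoundary ends e v * edgeBoundary ends e w := by
  unfold twVec
  split_ifs with h
  · subst h
    rw [card_filter, Nat.cast_sum]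
    congr 1
    refine sum_congr rfl fun e _ => ?_
    simp only [edgeBoundary, stdVec, eSym, Sym2.mem_iff, Sym2.mk_isDiag_iff, Pi.sub_apply]
    grind
  · rw [card_filter, Nat.cast_sum, ← sum_neg_distrib]
    refine sum_congr rfl fun e _ => ?_
    simp only [edgeBoundary, stdVec, eSym, Sym2.eq_iff, Pi.sub_apply]
    grind

theorem sum_twVec (ends : E → V × V) (A : Finset E) (v : V) : ∑ w, twVec ends A v w = 0 := by
  simp only [twVec_apply, sum_neg_distrib]
  rw [sum_comm]
  simp only [← mul_sum, sum_edgeBoundary, mul_zero, sum_const_zero, neg_zero]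

theorem sum_twVec_left (ends : E → V × V) (A : Finset E) (w : V) :
    ∑ v, twVec ends A v w = 0 := by
  simp only [twVec_apply, sum_neg_distrib]
  rw [sum_comm]
  simp only [← sum_mul, sum_edgeBoundary, zero_mul, sum_const_zero, neg_zero]

theorem restrictNe_twVec (ends : E → V × V) (r : V) (A : Finset E) (v : {v // v ≠ r}) :
    restrictNe r (twVec ends A v) = (reducedLaplacian ends r A).mulVecLin (-Pi.single v 1) := by
  ext w
  simp [restrictNe_apply, twVec_apply, reducedLaplacian_apply, Matrix.mulVec_neg, mul_comm]

theorem restrictNe_injective_of_sum_eq {r : V} {x y : V → ℤ} (hsum : ∑ v, x v = ∑ v, y v)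
    (h : restrictNe r x = restrictNe r y) : x = y := by
  have hne : ∀ v : {v // v ≠ r}, x v = y v := congrFun h
  ext v
  by_cases hv : v = r
  · subst hv
    rw [sum_eq_add_sum_ne v x, sum_eq_add_sum_ne v y] at hsum
    simp only [hne] at hsum
    exact add_right_cancel hsum
  · exact hne ⟨v, hv⟩

theorem mem_twGroup_iff (ends : E → V × V) (r : V) (A : Finset E) {x : V → ℤ}
    (hx : ∑ v, x v = 0) :
    x ∈ twGroup ends A ↔
      restrictNe r x ∈ LinearMap.range (reducedLaplacian ends r A).mulVecLin := by
  constructor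
  · intro h
    have hne : ∀ v : {v // v ≠ r}, restrictNe r (twVec ends A v) ∈
        LinearMap.range (reducedLaplacian ends r A).mulVecLin :=
      fun v => ⟨_, (restrictNe_twVec ends r A v).symm⟩
    have hle : twGroup ends A ≤ ((LinearMap.range (reducedLaplacian ends r A).mulVecLin).comap
        (restrictNe r)).toAddSubgroup := by
      rw [twGroup, AddSubgroup.closure_le]
      rintro _ ⟨v, rfl⟩
      change restrictNe r (twVec ends A v) ∈
        LinearMap.range (reducedLaplacian ends r A).mulVecLin
      by_cases hv : v = r
      · have hroot : twVec ends A v = -∑ u : {v // v ≠ r}, twVec ends A u := by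
          ext w
          have := sum_twVec_left ends A w
          rw [sum_eq_add_sum_ne r] at this
          simp only [Pi.neg_apply, Finset.sum_apply, hv]
          linarith
        rw [hroot, map_neg, map_sum]
        exact neg_mem (Submodule.sum_mem _ fun u _ => hne u)
      · exact hne ⟨v, hv⟩
    exact hle h
  · rintro ⟨y, hy⟩
    have hmem : ∀ v, twVec ends A v ∈ twGroup ends A :=
      fun v => AddSubgroup.subset_closure ⟨v, rfl⟩
    have hxy : x = ∑ v : {v // v ≠ r}, (-y v) • twVec ends A v := by
      refine restrictNe_injective_of_sum_eq (r := r) ?_ ?_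
      · rw [hx]
        simp only [Finset.sum_apply, Pi.smul_apply]
        rw [sum_comm]
        simp only [← smul_sum, sum_twVec, smul_zero, sum_const_zero]
      · simp only [map_sum, map_smul, restrictNe_twVec]
        rw [← hy]
        simp only [← map_smul, ← map_sum]
        congr 1
        ext w
        simp [Pi.single_apply]
    rw [hxy]
    exact sum_mem fun v _ => zsmul_mem (hmem v) _

theorem natCard_of_isRepSet {ends : E → V × V} {d : ℤ} {A : Finset E} {S : Set (V → ℤ)}
    (hA : Conn ends A) (hS : IsRepSet ends d A S) :
    Nat.card S = complexity ends A := by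
  obtain ⟨r⟩ := hA.1
  have hdet := det_reducedLaplacian_ne_zero r hA
  have hcard := Matrix.card_quotient_range_mulVecLin _ hdet
  rw [det_reducedLaplacian, Int.natAbs_natCast] at hcard
  rw [← hcard]
  have hsub : ∀ x ∈ Sdeg (V := V) d A, ∀ y ∈ Sdeg (V := V) d A, ∑ v : V, (x - y) v = 0 := by
    intro x hx y hy
    simp only [Pi.sub_apply, sum_sub_distrib]
    rw [show ∑ v, x v = _ from hx, show ∑ v, y v = _ from hy, sub_self]
  refine Nat.card_eq_of_bijective (fun x : S => Submodule.Quotient.mk (restrictNe r x.1)) ⟨?_, ?_⟩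
  · rintro ⟨x, hx⟩ ⟨y, hy⟩ hxy
    rw [Submodule.Quotient.eq, ← map_sub,
      ← mem_twGroup_iff ends r A (hsub x (hS.1 hx) y (hS.1 hy))] at hxy
    exact Subtype.ext ((hS.2 x (hS.1 hx)).unique ⟨hx, by simp⟩ ⟨hy, hxy⟩)
  · intro q
    obtain ⟨z, rfl⟩ := Submodule.Quotient.mk_surjective _ q
    let x : V → ℤ := fun v => if h : v = r then d - nG A - ∑ u, z u else z ⟨v, h⟩
    have hxz : restrictNe r x = z := by
      ext v
      exact dif_neg v.2
    have hx : x ∈ Sdeg (E := E) d A := by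
      change ∑ v, x v = _
      rw [sum_eq_add_sum_ne r]
      have hne : ∀ v : {v // v ≠ r}, x v = z v := congrFun hxz
      simp only [hne]
      simp [x]
    obtain ⟨y, ⟨hy, hxy⟩, -⟩ := hS.2 x hx
    refine ⟨⟨y, hy⟩, ?_⟩
    symm
    rw [← hxz, Submodule.Quotient.eq, ← map_sub,
      ← mem_twGroup_iff ends r A (hsub x hx y (hS.1 hy))]
    exact hxy

theorem finite_of_isRepSet {ends : E → V × V} {d : ℤ} {A : Finset E} {S : Set (V → ℤ)}
    (hA : Conn ends A) (hS : IsRepSet ends d A S) : S.Finite := by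
  obtain ⟨r⟩ := hA.1
  refine Set.finite_coe_iff.1 (Nat.finite_of_card_ne_zero ?_)
  rw [natCard_of_isRepSet hA hS]
  exact_mod_cast det_reducedLaplacian ends r A ▸ det_reducedLaplacian_ne_zero r hA

theorem Linked.mono {ends : E → V × V} {A B : Finset E} (hAB : A ⊆ B) {v w : V}
    (h : Linked ends A v w) : Linked ends B v w :=
  Linked.map (f := id) (fun _ he => Linked.ends (hAB he)) h

theorem complexity_eq_zero_of_not_conn {ends : E → V × V} {A : Finset E} (hA : ¬Conn ends A) :
    complexity ends A = 0 := by
  have : IsEmpty {T : Finset E // T ⊆ A ∧ IsSpanningTree ends T} :=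
    ⟨fun T => hA ⟨T.2.2.1.1, fun v w => (T.2.2.1.2 v w).mono T.2.1⟩⟩
  exact Nat.card_of_isEmpty

theorem liftOf_eq_liftOf {m : E → ℕ} {A A' : Finset E} {x x' : V → ℤ} {t t' : E → ℕ}
    (ht : ∀ e ∉ A, t e < m e) (ht' : ∀ e ∉ A', t' e < m e)
    (h : liftOf m A x t = liftOf m A' x' t') :
    A = A' ∧ x = x' ∧ ∀ e ∉ A, t e = t' e := by
  have key : ∀ {A A' : Finset E} {x x' : V → ℤ} {t t' : E → ℕ}, (∀ e ∉ A, t e < m e) →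
      liftOf m A x t = liftOf m A' x' t' → ∀ e ∉ A, e ∉ A' ∧ t e = t' e := by
    intro A A' x x' t t' ht h e he
    have := congrFun h (Sum.inr ⟨e, ⟨t e, ht e he⟩⟩)
    simp only [liftOf, Sum.elim_inr, he, not_false_eq_true, true_and, if_true] at this
    by_contra hne
    rw [if_neg hne] at this
    exact one_ne_zero this
  refine ⟨?_, funext fun v => congrFun h (Sum.inl v), fun e he => (key ht h e he).2⟩
  ext e
  exact not_iff_not.1 ⟨fun he => (key ht h e he).1, fun he => (key ht' h.symm e he).1⟩

theorem ncard_liftSet {ends : E → V × V} {d : ℤ} {σ : Finset E → Set (V → ℤ)}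
    (hσ : IsStabilityAssignment ends d σ) (m : E → ℕ) :
    (liftSet m σ).ncard = ∑ G : Finset E, (∏ e ∈ univ \ G, m e) * complexity ends G := by
  have hempty : ∀ A, ¬Conn ends A → σ A = ∅ := fun A hA =>
    Set.eq_empty_of_forall_notMem fun x hx => hA (hσ.1 A x hx).1
  have hfin : ∀ A, Finite (σ A) := fun A => by
    by_cases hA : Conn ends A
    · exact finite_of_isRepSet hA (hσ.2.2 A hA)
    · rw [hempty A hA]
      infer_instance
  have hcard : ∀ A, Nat.card (σ A) = complexity ends A := fun A => by
    by_cases hA : Conn ends A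
    · exact natCard_of_isRepSet hA (hσ.2.2 A hA)
    · rw [hempty A hA, complexity_eq_zero_of_not_conn hA]
      simp
  let T : (A : Finset E) → ((e : {e // e ∉ A}) → Fin (m e)) → E → ℕ :=
    fun A t e => if h : e ∉ A then t ⟨e, h⟩ else 0
  have hT : ∀ A t, ∀ e ∉ A, T A t e < m e := fun A t e he => by
    simp only [T, he, not_false_eq_true, dif_pos]
    exact (t ⟨e, he⟩).2
  let F : (Σ A : Finset E, ((e : {e // e ∉ A}) → Fin (m e)) × σ A) → liftSet m σ :=
    fun p => ⟨liftOf m p.1 p.2.2 (T p.1 p.2.1), p.1, p.2.2, T p.1 p.2.1, p.2.2.2, hT _ _, rfl⟩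
  have hF : Function.Bijective F := by
    constructor
    · rintro ⟨A, t, x, hx⟩ ⟨A', t', x', hx'⟩ h
      obtain ⟨rfl, rfl, htt⟩ := liftOf_eq_liftOf (hT _ _) (hT _ _) (Subtype.ext_iff.1 h)
      obtain rfl : t = t' := by
        ext e
        simpa [T, e.2] using htt e e.2
      rfl
    · rintro ⟨_, A, x, t, hx, ht, rfl⟩
      refine ⟨⟨A, fun e => ⟨t e, ht e e.2⟩, x, hx⟩, Subtype.ext ?_⟩
      ext (v | p)
      · rfl
      · simp only [F, T, liftOf, Sum.elim_inr]
        by_cases hp : p.1 ∈ A <;> simp [hp]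
  rw [← Nat.card_coe_set_eq, ← Nat.card_eq_of_bijective F hF, Nat.card_sigma]
  refine sum_congr rfl fun A _ => ?_
  rw [Nat.card_prod, hcard, Nat.card_pi]
  congr 1
  simp only [Nat.card_eq_fintype_card, Fintype.card_fin]
  exact (prod_subtype _ (by simp) m).symm

theorem subNode_zero (ends : E → V × V) (m : E → ℕ) (e : E) :
    subNode ends m e 0 = Sum.inl (ends e).1 := rfl

theorem subNode_succ (ends : E → V × V) (m : E → ℕ) (e : E) (k : Fin (m e)) :
    subNode ends m e (k + 1) = Sum.inr ⟨e, k⟩ := by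
  simp [subNode]

theorem subNode_last (ends : E → V × V) (m : E → ℕ) (e : E) :
    subNode ends m e (m e + 1) = Sum.inl (ends e).2 := by
  simp [subNode]

theorem linked_subNode {ends : E → V × V} {m : E → ℕ} {S : Finset (SubE E m)} {e : E} {a b : ℕ}
    (hab : a ≤ b) (hb : b ≤ m e + 1)
    (hS : ∀ l : Fin (m e + 1), a ≤ l → l < b → (⟨e, l⟩ : SubE E m) ∈ S) :
    Linked (subEnds ends m) S (subNode ends m e a) (subNode ends m e b) := by
  induction b, hab using Nat.le_induction with
  | base => exact .refl
  | succ b hab ih =>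
    refine (ih (by omega) fun l h1 h2 => hS l h1 (by omega)).trans ?_
    exact Linked.ends (hS ⟨b, by omega⟩ hab (Nat.lt_succ_self b))

/-- The spanning subgraph of the subdivision where the chain of each edge `e` misses
the edge recorded by `o e`, if any. -/
def chainSubgraph {m : E → ℕ} (o : (e : E) → Option (Fin (m e + 1))) : Finset (SubE E m) :=
  univ.filter fun p => o p.1 ≠ some p.2

/-- The edges of the original graph whose chains are complete in `chainSubgraph o`. -/
def fullEdges {m : E → ℕ} (o : (e : E) → Option (Fin (m e + 1))) : Finset E :=
  univ.filter fun e => o e = none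

theorem mem_chainSubgraph {m : E → ℕ} {o : (e : E) → Option (Fin (m e + 1))} {p : SubE E m} :
    p ∈ chainSubgraph o ↔ o p.1 ≠ some p.2 := by
  simp [chainSubgraph]

theorem mem_fullEdges {m : E → ℕ} {o : (e : E) → Option (Fin (m e + 1))} {e : E} :
    e ∈ fullEdges o ↔ o e = none := by
  simp [fullEdges]

theorem chainSubgraph_injective (m : E → ℕ) :
    Function.Injective (chainSubgraph : ((e : E) → Option (Fin (m e + 1))) → _) := by
  intro o o' h
  ext e i
  have : (⟨e, i⟩ : SubE E m) ∈ chainSubgraph o ↔ ⟨e, i⟩ ∈ chainSubgraph o' := by rw [h]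
  simpa [mem_chainSubgraph, not_iff_not] using this

theorem exists_chainSubgraph_eq {ends : E → V × V} {m : E → ℕ} {S : Finset (SubE E m)}
    (hS : Conn (subEnds ends m) S) : ∃ o, chainSubgraph o = S := by
  classical
  have huniq : ∀ e, ∀ i j : Fin (m e + 1), (⟨e, i⟩ : SubE E m) ∉ S → (⟨e, j⟩ : SubE E m) ∉ S →
      ¬i < j := by
    intro e i j hi hj hij
    have hjm := j.2
    let f : SubV V E m → Prop :=
      Sum.elim (fun _ => False) fun p => p.1 = e ∧ (i : ℕ) ≤ p.2 ∧ (p.2 : ℕ) < j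
    have hf : ∀ e' k, f (subNode ends m e' k) = (e' = e ∧ (i : ℕ) < k ∧ k ≤ (j : ℕ)) := by
      intro e' k
      unfold subNode
      split_ifs with h0 h1
      · simp [f, h0]
      · simp only [f, Sum.elim_inr, eq_iff_iff]
        refine and_congr_right fun _ => ?_
        omega
      · simp only [f, Sum.elim_inl, eq_iff_iff, false_iff]
        rintro ⟨rfl, h2, h3⟩
        omega
    have hedge : ∀ p ∈ S, f (subEnds ends m p).1 = f (subEnds ends m p).2 := by
      rintro ⟨e', l⟩ hl
      simp only [subEnds, hf, eq_iff_iff]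
      refine and_congr_right fun he => ?_
      subst he
      have hli : (l : ℕ) ≠ i := fun h => hi (Fin.ext h ▸ hl)
      have hlj : (l : ℕ) ≠ j := fun h => hj (Fin.ext h ▸ hl)
      omega
    have := (hS.2 (subNode ends m e 0) (subNode ends m e (i + 1))).apply_eq hedge
    simp only [hf, eq_iff_iff, true_and] at this
    have hij' : (i : ℕ) < j := hij
    omega
  have hex : ∀ e, ∃ x : Option (Fin (m e + 1)), ∀ i, x ≠ some i ↔ (⟨e, i⟩ : SubE E m) ∈ S := by
    intro e
    by_cases h : ∃ i, (⟨e, i⟩ : SubE E m) ∉ S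
    · obtain ⟨i, hi⟩ := h
      refine ⟨some i, fun j => ?_⟩
      rw [← not_iff_not, not_not, Option.some_inj]
      refine ⟨fun h => h ▸ hi, fun hj => ?_⟩
      exact le_antisymm (not_lt.1 (huniq e j i hj hi)) (not_lt.1 (huniq e i j hi hj))
    · push Not at h
      exact ⟨none, fun i => by simp [h i]⟩
  choose o ho using hex
  exact ⟨o, by ext ⟨e, i⟩; rw [mem_chainSubgraph]; exact ho e i⟩

theorem conn_chainSubgraph_iff {ends : E → V × V} {m : E → ℕ}
    (o : (e : E) → Option (Fin (m e + 1))) :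
    Conn (subEnds ends m) (chainSubgraph o) ↔ Conn ends (fullEdges o) := by
  constructor
  · intro h
    let π : SubV V E m → V := Sum.elim id fun p =>
      if ∀ j ∈ o p.1, (p.2 : ℕ) < j then (ends p.1).1 else (ends p.1).2
    have hπ : ∀ e k, k ≤ m e + 1 → π (subNode ends m e k) =
        if k ≤ m e ∧ ∀ j ∈ o e, k ≤ (j : ℕ) then (ends e).1 else (ends e).2 := by
      intro e k hk
      unfold subNode
      split_ifs with h0 h1 h2 h3 h3
      · rfl
      · exact absurd ⟨h0 ▸ Nat.zero_le _, fun j _ => h0 ▸ Nat.zero_le _⟩ h1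
      · simp only [π, Sum.elim_inr]
        exact if_pos fun j hj => by have := h3.2 j hj; omega
      · simp only [π, Sum.elim_inr]
        exact if_neg fun h4 => h3 ⟨h2, fun j hj => by have := h4 j hj; omega⟩
      · exact absurd h3.1 h2
      · rfl
    have hmap : ∀ p ∈ chainSubgraph o, Linked ends (fullEdges o)
        (π (subEnds ends m p).1) (π (subEnds ends m p).2) := by
      rintro ⟨e, l⟩ hl
      rw [mem_chainSubgraph] at hl
      simp only [subEnds]
      rw [hπ e l (by omega), hπ e (l + 1) (by omega)]
      cases ho : o e with
      | none =>
        have he := mem_fullEdges.2 ho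
        split_ifs
        exacts [.refl, Linked.ends he, Linked.ends_swap he, .refl]
      | some j =>
        have hlj : (l : ℕ) ≠ j := fun h => hl (by rw [ho, Fin.ext h])
        have hiff : ((l : ℕ) ≤ m e ∧ ∀ i ∈ some j, (l : ℕ) ≤ i) ↔
            ((l : ℕ) + 1 ≤ m e ∧ ∀ i ∈ some j, (l : ℕ) + 1 ≤ i) := by
          simp only [Option.mem_some_iff, forall_eq']
          omega
        simp only [hiff]
        exact .refl
    obtain ⟨v⟩ := h.1
    exact ⟨⟨π v⟩, fun a b => Linked.map (f := π) hmap (h.2 (Sum.inl a) (Sum.inl b))⟩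
  · intro h
    obtain ⟨r⟩ := h.1
    have hV : ∀ v, Linked (subEnds ends m) (chainSubgraph o) (Sum.inl r) (Sum.inl v) := by
      intro v
      refine Linked.map (f := Sum.inl) (fun e he => ?_) (h.2 r v)
      rw [← subNode_zero, ← subNode_last]
      refine linked_subNode (Nat.zero_le _) le_rfl fun l _ _ => ?_
      rw [mem_chainSubgraph]
      simp [mem_fullEdges.1 he]
    refine conn_of_linked_root (Sum.inl r) ?_
    rintro (v | ⟨e, k⟩)
    · exact hV v
    · rw [← subNode_succ ends]
      by_cases hk : ∀ j ∈ o e, (k : ℕ) < j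
      · refine (hV (ends e).1).trans ?_
        rw [← subNode_zero]
        refine linked_subNode (Nat.zero_le _) (by omega) fun l _ hl => ?_
        rw [mem_chainSubgraph]
        intro ho
        have := hk l ho
        omega
      · push Not at hk
        obtain ⟨j, hj, hjk⟩ := hk
        refine (hV (ends e).2).trans ?_
        rw [← subNode_last]
        refine (linked_subNode (by omega) le_rfl fun l hl _ => ?_).symm
        rw [mem_chainSubgraph]
        intro ho
        have : j = l := Option.some_inj.1 (hj.symm.trans ho)
        omega

theorem card_chainSubgraph {m : E → ℕ} (o : (e : E) → Option (Fin (m e + 1))) :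
    (chainSubgraph o).card = ∑ e, m e + (fullEdges o).card := by
  have hsigma : chainSubgraph o = univ.sigma fun e => univ.filter fun i => o e ≠ some i := by
    ext ⟨e, i⟩
    simp [chainSubgraph]
  rw [hsigma, card_sigma, fullEdges, card_filter, ← sum_add_distrib]
  refine sum_congr rfl fun e _ => ?_
  cases o e with
  | none => simp
  | some j =>
    have : (univ.filter fun i => some j ≠ some i) = univ.erase j := by
      ext i
      simp [eq_comm]
    rw [this, card_erase_of_mem (mem_univ _)]
    simp

theorem isSpanningTree_chainSubgraph_iff {ends : E → V × V} {m : E → ℕ}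
    (o : (e : E) → Option (Fin (m e + 1))) :
    IsSpanningTree (subEnds ends m) (chainSubgraph o) ↔ IsSpanningTree ends (fullEdges o) := by
  refine and_congr (conn_chainSubgraph_iff o) ?_
  rw [card_chainSubgraph, Fintype.card_sum, Fintype.card_sigma]
  simp only [Fintype.card_fin]
  omega

theorem card_fullEdges_eq {m : E → ℕ} (T : Finset E) :
    (univ.filter fun o : (e : E) → Option (Fin (m e + 1)) => fullEdges o = T).card =
      ∏ e ∈ univ \ T, (m e + 1) := by
  have hpi : (univ.filter fun o : (e : E) → Option (Fin (m e + 1)) => fullEdges o = T) =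
      Fintype.piFinset fun e => if e ∈ T then {none} else univ.erase none := by
    ext o
    simp only [mem_filter, mem_univ, true_and, Fintype.mem_piFinset, Finset.ext_iff, mem_fullEdges]
    refine forall_congr' fun e => ?_
    by_cases he : e ∈ T <;> simp [he]
  rw [hpi, Fintype.card_piFinset, ← prod_subset (subset_univ (univ \ T))]
  · refine prod_congr rfl fun e he => ?_
    have : e ∉ T := (mem_sdiff.1 he).2
    simp [this, card_erase_of_mem]
  · intro e _ he
    have : e ∈ T := by simpa using he
    simp [this]

theorem complexity_subEnds (ends : E → V × V) (m : E → ℕ) [DecidablePred (IsSpanningTree ends)] :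
    complexity (subEnds ends m) univ =
      ∑ T : Finset E with IsSpanningTree ends T, ∏ e ∈ univ \ T, (m e + 1) := by
  classical
  let F : {o : (e : E) → Option (Fin (m e + 1)) // IsSpanningTree ends (fullEdges o)} →
      {T : Finset (SubE E m) // T ⊆ univ ∧ IsSpanningTree (subEnds ends m) T} :=
    fun o => ⟨chainSubgraph o.1, subset_univ _, (isSpanningTree_chainSubgraph_iff o.1).2 o.2⟩
  have hF : Function.Bijective F := by
    constructor
    · intro o o' h
      exact Subtype.ext (chainSubgraph_injective m (Subtype.ext_iff.1 h))
    · rintro ⟨S, hS, hT⟩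
      obtain ⟨o, rfl⟩ := exists_chainSubgraph_eq hT.1
      exact ⟨⟨o, (isSpanningTree_chainSubgraph_iff o).1 hT⟩, rfl⟩
  rw [complexity, ← Nat.card_eq_of_bijective F hF, Nat.card_eq_fintype_card, Fintype.card_subtype,
    card_eq_sum_card_fiberwise (f := fullEdges)
      (t := univ.filter fun T => IsSpanningTree ends T) (fun o ho => by simpa using ho)]
  refine sum_congr rfl fun T hT => ?_
  rw [← card_fullEdges_eq, filter_filter]
  congr 1
  refine filter_congr fun o _ => ?_
  rw [and_iff_right_iff_imp]
  rintro rfl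
  exact (mem_filter.1 hT).2

theorem sum_prod_superset (m : E → ℕ) (T : Finset E) :
    ∑ G : Finset E with T ⊆ G, ∏ e ∈ univ \ G, m e = ∏ e ∈ univ \ T, (m e + 1) := by
  rw [prod_add_one]
  refine sum_bij' (fun G _ => univ \ G) (fun H _ => univ \ H) ?_ ?_ ?_ ?_ fun _ _ => rfl
  · intro G hG
    exact mem_powerset.2 (sdiff_subset_sdiff Subset.rfl (mem_filter.1 hG).2)
  · intro H hH
    refine mem_filter.2 ⟨mem_univ _, fun e he => mem_sdiff.2 ⟨mem_univ e, fun heH => ?_⟩⟩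
    exact (mem_sdiff.1 (mem_powerset.1 hH heH)).2 he
  · intro G _
    simp
  · intro H _
    simp

theorem sum_prod_mul_complexity (ends : E → V × V) (m : E → ℕ) :
    ∑ G : Finset E, (∏ e ∈ univ \ G, m e) * complexity ends G =
      complexity (subEnds ends m) univ := by
  classical
  have hc : ∀ G, complexity ends G =
      ∑ T : Finset E with IsSpanningTree ends T, if T ⊆ G then 1 else 0 := by
    intro G
    rw [complexity, Nat.card_eq_fintype_card, Fintype.card_subtype, ← card_filter, filter_filter]
    simp only [and_comm]
  rw [complexity_subEnds]
  simp only [hc, mul_sum]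
  rw [sum_comm]
  refine sum_congr rfl fun T _ => ?_
  rw [← sum_prod_superset, sum_filter]
  simp

/-- For a degree-`d` stability assignment `σ` on a connected multigraph
`Γ` and any `m : Edges(Γ) → ℕ`, the number of elements of the lift `σ̃_m` equals
`Σ_G (∏_{e ∉ G} m e) · c(G)` (sum over all connected spanning subgraphs `G`; the summand
vanishes for disconnected `G`), which equals the complexity `c(Γ̃_m)` of the subdivision. -/
theorem statement14 (ends : E → V × V) (d : ℤ) (σ : Finset E → Set (V → ℤ))
    (hconn : Conn ends (Finset.univ : Finset E))
    (hσ : IsStabilityAssignment ends d σ) (m : E → ℕ) :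
    (liftSet m σ).ncard =
        ∑ G : Finset E, (∏ e ∈ Finset.univ \ G, m e) * complexity ends G ∧
      (liftSet m σ).ncard =
        complexity (subEnds ends m) (Finset.univ : Finset (SubE E m)) := by
  have h := ncard_liftSet hσ m
  exact ⟨h, h.trans (sum_prod_mul_complexity ends m)⟩
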